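/- Let (M,l,r) be a bimodule over an anti-flexible algebra (A,·), and let N ∈ End(A), S ∈ End(M). Then N is a Nijenhuis operator on (A,·) and S satisfies l(N(a))S(m) = S(l(N(a))m + l(a)S(m) − S(l(a)m)) and r(N(a))S(m) = S(r(N(a))m + r(a)S(m) − S(r(a)m)) for all a ∈ A, m ∈ M, if and only if the map N ⊕ S on A ⊕ M defined by (N ⊕ S)(a,m) = (N(a), S(m)) is a Nijenhuis operator on the semidirect product anti-flexible algebra A ⊕ M. -/

import Mathlib

/-- The anti-flexible identity for a (bilinear) product. -/
def AntiFlexible {A : Type*} [AddCommGroup A] (mul : A → A → A) : Prop :=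
  ∀ a b c : A, mul (mul a b) c - mul a (mul b c) = mul (mul c b) a - mul c (mul b a)

/-- The bimodule equations for `(M, l, r)` over `(A, mul)`. -/
def IsBimodule {K A M : Type*} [Field K] [AddCommGroup A] [Module K A]
    [AddCommGroup M] [Module K M]
    (mul : A →ₗ[K] A →ₗ[K] A) (l r : A →ₗ[K] Module.End K M) : Prop :=
  (∀ a b : A, l (mul a b) - l a * l b = r a * r b - r (mul b a)) ∧
  (∀ a b : A, l a * r b - r b * l a = l b * r a - r a * l b)

/-- Nijenhuis operator on `(A, mul)`. -/
def IsNijenhuis {A : Type*} [AddCommGroup A] (mul : A → A → A) (N : A → A) : Prop :=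
  ∀ a b : A, mul (N a) (N b) = N (mul (N a) b + mul a (N b) - N (mul a b))

/-- The semidirect product multiplication on `A ⊕ M`. -/
def mulSD {K A M : Type*} [Field K] [AddCommGroup A] [Module K A]
    [AddCommGroup M] [Module K M]
    (mul : A →ₗ[K] A →ₗ[K] A) (l r : A →ₗ[K] Module.End K M) :
    A × M → A × M → A × M :=
  fun p q => (mul p.1 q.1, l p.1 q.2 + r q.1 p.2)

/-- `N` is a Nijenhuis operator on `(A, ·)` and `S` satisfies the
compatibility equations iff `N ⊕ S` is a Nijenhuis operator on the semidirect product
anti-flexible algebra `A ⊕ M`. -/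
theorem nijenhuis_semidirect_iff {K A M : Type*} [Field K]
    [AddCommGroup A] [Module K A] [AddCommGroup M] [Module K M]
    (mul : A →ₗ[K] A →ₗ[K] A) (hA : AntiFlexible fun a b => mul a b)
    (l r : A →ₗ[K] Module.End K M) (hbim : IsBimodule mul l r)
    (N : A →ₗ[K] A) (S : Module.End K M) :
    (IsNijenhuis (fun a b => mul a b) N ∧
      (∀ (a : A) (m : M),
        l (N a) (S m) = S (l (N a) m + l a (S m) - S (l a m))) ∧
      (∀ (a : A) (m : M),
        r (N a) (S m) = S (r (N a) m + r a (S m) - S (r a m)))) ↔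
    IsNijenhuis (mulSD mul l r) (fun p : A × M => ((N p.1, S p.2) : A × M)) := by
  simp only [IsNijenhuis, mulSD, Prod.forall, Prod.mk_add_mk, Prod.mk_sub_mk, Prod.mk.injEq]
  constructor
  · rintro ⟨hN, hl, hr⟩ a m b n
    refine ⟨hN a b, ?_⟩
    rw [hl a n, hr b m, ← map_add]
    congr 1
    rw [map_add]
    abel
  · intro h
    refine ⟨fun a b => (h a 0 b 0).1, fun a m => ?_, fun a m => ?_⟩
    · simpa using (h a 0 0 m).2
    · simpa [add_comm] using (h 0 m a 0).2
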